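/- Let ν ∈ P_1(R^d) satisfy a T_1(λ) inequality: W_1(μ,ν) ≤ √(2λ·KL(μ‖ν)) for all μ ≪ ν. Then for any exchangeable probability measure π on (R^d)^N with q-marginal π^{(q)}, W_1(π^{(q)}, ν^{⊗q}) ≤ √(2λq·KL(π^{(q)}‖ν^{⊗q})) ≤ C·(q/√N)·√(λ·KL(π‖ν^{⊗N})), i.e. the propagation of chaos bound scales linearly in q and as N^{-1/2}. -/

import Mathlib

open MeasureTheory ENNReal

noncomputable section

abbrev Ed (d : ℕ) := EuclideanSpace ℝ (Fin d)

/-- Optimal transport cost between two measures for a given cost function. -/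
def Wc {X Y : Type*} [MeasurableSpace X] [MeasurableSpace Y] (cost : X → Y → ℝ)
    (μ : Measure X) (ν : Measure Y) : ℝ :=
  sInf {r | ∃ γ : Measure (X × Y), γ.map Prod.fst = μ ∧ γ.map Prod.snd = ν ∧
    r = ∫ p, cost p.1 p.2 ∂γ}

/-- 1-Wasserstein distance. -/
def W1 {X : Type*} [MeasurableSpace X] [PseudoMetricSpace X] (μ ν : Measure X) : ℝ :=
  Wc dist μ ν

/-- ℓ₂ product cost on (ℝ^d)^q. -/
def l2cost {d q : ℕ} (x y : Fin q → Ed d) : ℝ := Real.sqrt (∑ i, ‖x i - y i‖ ^ 2)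

/-- 1-Wasserstein distance on the product space with the ℓ₂ product metric. -/
def W1q {d q : ℕ} (μ ν : Measure (Fin q → Ed d)) : ℝ := Wc l2cost μ ν

/-- Empirical measure of `N` points. -/
def emp {X : Type*} [MeasurableSpace X] {N : ℕ} (x : Fin N → X) : Measure X :=
  (N : ℝ≥0∞)⁻¹ • ∑ i, Measure.dirac (x i)

/-- Membership in P₁: probability with finite first moment. -/
def memP1 {X : Type*} [MeasurableSpace X] [NormedAddCommGroup X] (μ : Measure X) : Prop :=
  IsProbabilityMeasure μ ∧ HasFiniteIntegral (fun x => ‖x‖) μ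

open Classical in
/-- Kullback–Leibler divergence, valued in `[0,∞]`. -/
def KL {X : Type*} [MeasurableSpace X] (μ ν : Measure X) : ℝ≥0∞ :=
  if μ ≪ ν ∧ Integrable (fun x => Real.log ((μ.rnDeriv ν x).toReal)) μ
  then ENNReal.ofReal (∫ x, Real.log ((μ.rnDeriv ν x).toReal) ∂μ) else ⊤

/-- 2-Wasserstein distance. -/
def W2 {X : Type*} [MeasurableSpace X] [PseudoMetricSpace X] (μ ν : Measure X) : ℝ :=
  Real.sqrt (Wc (fun x y => dist x y ^ 2) μ ν)

open ProbabilityTheory InformationTheory Set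

lemma KL_eq_klDiv {X : Type*} [MeasurableSpace X] (μ ν : Measure X) [IsProbabilityMeasure μ]
    [IsProbabilityMeasure ν] : KL μ ν = klDiv μ ν := by
  unfold KL
  split_ifs with h
  · rw [klDiv_of_ac_of_integrable h.1 h.2]
    simp [llr_def]
  · symm
    rw [klDiv_eq_top_iff]
    exact fun h1 h2 => h ⟨h1, h2⟩

lemma klDiv_superadd {X Y : Type*} [MeasurableSpace X] [MeasurableSpace Y] [StandardBorelSpace Y]
    [Nonempty Y] (μ : Measure (X × Y)) [IsProbabilityMeasure μ] (P : Measure X)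
    [IsProbabilityMeasure P] (Q : Measure Y) [IsProbabilityMeasure Q] :
    klDiv μ.fst P + klDiv μ.snd Q ≤ klDiv μ (P.prod Q) := by
  have h1 : μ = μ.fst ⊗ₘ μ.condKernel := (μ.disintegrate μ.condKernel).symm
  conv_rhs => rw [h1]
  rw [← Measure.compProd_const, klDiv_compProd_eq_add, ← h1, Measure.compProd_const]
  gcongr
  have h2 := klDiv_map_le μ (μ.fst.prod Q) (g := Prod.snd) measurable_snd
  have h3 : (μ.fst.prod Q).map Prod.snd = Q := by
    rw [Measure.map_snd_prod]; simp
  rw [h3] at h2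
  exact h2

lemma pi_split {E : Type*} [MeasurableSpace E] (ν : Measure E) [IsProbabilityMeasure ν] (q n : ℕ) :
    (Measure.pi fun _ : Fin (q + n) => ν).map
      (fun x => ((fun i => x (Fin.castAdd n i) : Fin q → E), (fun i => x (Fin.natAdd q i) : Fin n → E)))
      = (Measure.pi fun _ : Fin q => ν).prod (Measure.pi fun _ : Fin n => ν) := by
  have hm : Measurable (fun p : (Fin q → E) × (Fin n → E) => (Fin.append p.1 p.2 : Fin (q+n) → E)) := by
    rw [measurable_pi_iff]
    intro i
    refine Fin.addCases (fun i => ?_) (fun i => ?_) i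
    · simp only [Fin.append_left]; fun_prop
    · simp only [Fin.append_right]; fun_prop
  have h : (Measure.pi fun _ : Fin (q + n) => ν) =
      ((Measure.pi fun _ : Fin q => ν).prod (Measure.pi fun _ : Fin n => ν)).map
        (fun p : (Fin q → E) × (Fin n → E) => (Fin.append p.1 p.2 : Fin (q+n) → E)) := by
    refine Measure.pi_eq fun s hs => ?_
    rw [Measure.map_apply hm (MeasurableSet.univ_pi hs), Fin.prod_univ_add]
    have : (fun p : (Fin q → E) × (Fin n → E) => (Fin.append p.1 p.2 : Fin (q+n) → E)) ⁻¹'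
        (univ.pi s) = (univ.pi fun i => s (Fin.castAdd n i)) ×ˢ
          (univ.pi fun i => s (Fin.natAdd q i)) := by
      ext p
      simp only [mem_preimage, mem_univ_pi, mem_prod]
      constructor
      · intro h
        exact ⟨fun i => by simpa using h (Fin.castAdd n i), fun i => by simpa using h (Fin.natAdd q i)⟩
      · rintro ⟨h1, h2⟩ i
        refine Fin.addCases (fun i => ?_) (fun i => ?_) i
        · simpa using h1 i
        · simpa using h2 i
    rw [this, Measure.prod_prod, Measure.pi_pi, Measure.pi_pi]
  rw [h, Measure.map_map (by fun_prop) hm]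
  convert Measure.map_id
  ext p <;> simp

lemma klDiv_blocks {E : Type*} [MeasurableSpace E] [StandardBorelSpace E] [Nonempty E]
    (ν : Measure E) [IsProbabilityMeasure ν] (q : ℕ)
    (ρ : Measure (Fin q → E)) (m : ℕ) : ∀ (n : ℕ), m * q ≤ n → ∀ (μ : Measure (Fin n → E)),
    IsProbabilityMeasure μ → (∀ s : Fin q → Fin n, Function.Injective s →
      μ.map (fun x i => x (s i)) = ρ) →
    (m : ℝ≥0∞) * klDiv ρ (Measure.pi fun _ => ν) ≤ klDiv μ (Measure.pi fun _ => ν) := by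
  induction m with
  | zero => intro n _ μ _ _; simp
  | succ m ih =>
    intro n hn μ hμ hs
    obtain ⟨n', rfl⟩ : ∃ n', n = q + n' := ⟨n - q, by
      have : q ≤ (m+1) * q := by nlinarith
      omega⟩
    have hn' : m * q ≤ n' := by
      have : (m+1) * q = m * q + q := by ring
      omega
    let g : (Fin (q+n') → E) → (Fin q → E) × (Fin n' → E) :=
      fun x => ((fun i => x (Fin.castAdd n' i)), (fun i => x (Fin.natAdd q i)))
    have hg : Measurable g := by fun_prop
    have h1 := klDiv_map_le μ (Measure.pi fun _ => ν) hg
    have h2 : (Measure.pi fun _ => ν).map g = _ := pi_split ν q n'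
    rw [h2] at h1
    have : IsProbabilityMeasure (μ.map g) := Measure.isProbabilityMeasure_map hg.aemeasurable
    refine le_trans ?_ (le_trans (klDiv_superadd (μ.map g) _ _) h1)
    have h3 : (μ.map g).fst = ρ := by
      rw [Measure.fst, Measure.map_map measurable_fst hg]
      exact hs _ (Fin.castAdd_injective q n')
    have h4 : (μ.map g).snd = μ.map (fun x i => x (Fin.natAdd q i)) := by
      rw [Measure.snd, Measure.map_map measurable_snd hg]
      rfl
    rw [h3, h4]
    have := ih n' hn' (μ.map (fun x i => x (Fin.natAdd q i)))
      (Measure.isProbabilityMeasure_map (Measurable.aemeasurable (by fun_prop))) (by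
        intro s hs'
        rw [Measure.map_map (by fun_prop) (by fun_prop)]
        exact hs (fun i => Fin.natAdd q (s i)) (fun a b h => hs' (by simpa using h)))
    calc ((m + 1 : ℕ) : ℝ≥0∞) * klDiv ρ (Measure.pi fun _ => ν)
        = klDiv ρ (Measure.pi fun _ => ν) + m * klDiv ρ (Measure.pi fun _ => ν) := by
          push_cast; ring
      _ ≤ _ := by gcongr

lemma csiszar {E : Type*} [MeasurableSpace E] [StandardBorelSpace E] [Nonempty E]
    (ν : Measure E) [IsProbabilityMeasure ν] (N q : ℕ) (hq1 : 1 ≤ q) (hqN : q ≤ N)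
    (π : Measure (Fin N → E)) (hπ : IsProbabilityMeasure π)
    (hex : ∀ σ : Equiv.Perm (Fin N), π.map (fun x => x ∘ σ) = π) :
    (N : ℝ≥0∞) * klDiv (π.map fun x (i : Fin q) => x (Fin.castLE hqN i))
      (Measure.pi fun _ : Fin q => ν) ≤ 2 * q * klDiv π (Measure.pi fun _ : Fin N => ν) := by
  have key := klDiv_blocks ν q (π.map fun x (i : Fin q) => x (Fin.castLE hqN i)) (N / q) N
    (Nat.div_mul_le_self N q) π hπ (by
      intro s hs
      obtain ⟨σ, hσ⟩ : ∃ σ : Equiv.Perm (Fin N), ∀ i, σ (Fin.castLE hqN i) = s i := by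
        exact Equiv.Perm.exists_extending_pair (Fin.castLE hqN) s (Fin.castLE_injective hqN) hs
      conv_rhs => rw [← hex σ]
      rw [Measure.map_map (by fun_prop) (by fun_prop)]
      congr 1
      ext x i
      simp [hσ])
  have hN : N ≤ 2 * q * (N / q) := by
    have h1 : 1 ≤ N / q := (Nat.one_le_div_iff (by omega)).2 hqN
    have h2 := Nat.div_add_mod N q
    have h3 := Nat.mod_lt N (show 0 < q by omega)
    nlinarith
  generalize klDiv (π.map fun x (i : Fin q) => x (Fin.castLE hqN i))
      (Measure.pi fun _ : Fin q => ν) = D at key ⊢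
  calc (N : ℝ≥0∞) * D ≤ ((2 * q * (N / q) : ℕ) : ℝ≥0∞) * D := by gcongr
    _ = 2 * q * (((N / q : ℕ) : ℝ≥0∞) * D) := by push_cast; ring
    _ ≤ _ := by gcongr

lemma final_arith (lam : ℝ) (N q : ℕ) (hN : 0 < N) (D K : ℝ≥0∞)
    (h : (N : ℝ≥0∞) * D ≤ 2 * q * K) :
    (2 * ENNReal.ofReal lam * (q : ℝ≥0∞) * D) ^ (1/2 : ℝ) ≤
     ENNReal.ofReal 2 * ((q : ℝ≥0∞) / ENNReal.ofReal (Real.sqrt N)) *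
              (ENNReal.ofReal lam * K) ^ (1/2 : ℝ) := by
  have hs : ENNReal.ofReal (Real.sqrt N) = (N : ℝ≥0∞) ^ (1/2 : ℝ) := by
    rw [Real.sqrt_eq_rpow, ← ENNReal.ofReal_rpow_of_nonneg (by positivity) (by norm_num)]
    simp
  have hsq : ∀ a : ℝ≥0∞, (a ^ 2) ^ (1/2 : ℝ) = a := by
    intro a
    rw [← ENNReal.rpow_natCast, ← ENNReal.rpow_mul]; norm_num
  have hN0 : (N : ℝ≥0∞) ≠ 0 := by simpa using hN.ne'
  have e : ENNReal.ofReal 2 * ((q : ℝ≥0∞) / ENNReal.ofReal (Real.sqrt N)) *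
              (ENNReal.ofReal lam * K) ^ (1/2 : ℝ) =
      (((2 * q) ^ 2 / N) * (ENNReal.ofReal lam * K)) ^ (1/2 : ℝ) := by
    rw [ENNReal.mul_rpow_of_nonneg (_ / _) _ (by norm_num), ENNReal.div_rpow_of_nonneg _ _ (by norm_num),
      hsq, hs, mul_div_assoc]
    simp
  rw [e]
  refine ENNReal.rpow_le_rpow ?_ (by norm_num)
  have hD : D ≤ 2 * q * K / N := by
    rw [ENNReal.le_div_iff_mul_le (Or.inl hN0) (Or.inl (by simp)), mul_comm]; exact h
  calc 2 * ENNReal.ofReal lam * (q : ℝ≥0∞) * D ≤ 2 * ENNReal.ofReal lam * (q : ℝ≥0∞) * (2 * q * K / N) := by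
        gcongr
    _ = _ := by simp only [div_eq_mul_inv]; ring

section mixing
set_option linter.unusedSectionVars false
variable {E : Type*} [NormedAddCommGroup E] [MeasurableSpace E] [BorelSpace E]
  [SecondCountableTopology E]

/-- Coupling of `f ν` with `ν` built from a coupling `γ` of `g ν` with `ν`. -/
def mixM (ν : Measure E) (f g : E → NNReal) (γ : Measure (E × E)) : Measure (E × E) :=
  γ.withDensity (fun p => ((min (f p.1) (g p.1) / g p.1 : NNReal) : ℝ≥0∞)) +
    ((ν.withDensity (fun y => ((f y - g y : NNReal) : ℝ≥0∞))).prod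
      ((γ.withDensity (fun p => ((1 - min (f p.1) (g p.1) / g p.1 : NNReal) : ℝ≥0∞))).map
        Prod.snd)).withDensity (fun _ => (∫⁻ y, ((f y - g y : NNReal) : ℝ≥0∞) ∂ν)⁻¹)

lemma mix_w_mul (a b : NNReal) : b * (min a b / b) = min a b := by
  by_cases hb : b = 0
  · simp [hb]
  · field_simp

lemma mix_w_le (a b : NNReal) : min a b / b ≤ 1 := div_le_one_of_le₀ (min_le_right _ _) (by positivity)

lemma mix_w_mul' (a b : NNReal) : b * (1 - min a b / b) = b - a := by
  rw [mul_tsub, mix_w_mul, mul_one]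
  rcases le_total a b with h | h
  · rw [min_eq_left h]
  · rw [min_eq_right h, tsub_self, tsub_eq_zero_of_le h]

lemma lintegral_fst_coupling {γ : Measure (E × E)} {ν : Measure E} {g : E → NNReal}
    (hg : Measurable g)
    (hγ : γ.map Prod.fst = ν.withDensity (fun y => (g y : ℝ≥0∞))) {h : E → ℝ≥0∞}
    (hh : Measurable h) : ∫⁻ p, h p.1 ∂γ = ∫⁻ y, g y * h y ∂ν := by
  rw [← lintegral_map hh measurable_fst, hγ, lintegral_withDensity_eq_lintegral_mul _ (by fun_prop) hh]
  rfl

lemma map_fst_withDensity {γ : Measure (E × E)} {ν : Measure E} {g : E → NNReal}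
    (hg : Measurable g)
    (hγ : γ.map Prod.fst = ν.withDensity (fun y => (g y : ℝ≥0∞))) {h : E → ℝ≥0∞}
    (hh : Measurable h) : (γ.withDensity (fun p => h p.1)).map Prod.fst =
      ν.withDensity (fun y => g y * h y) := by
  ext s hs
  rw [Measure.map_apply measurable_fst hs, withDensity_apply _ (measurable_fst hs),
    withDensity_apply _ hs, ← lintegral_indicator hs, ← lintegral_indicator (measurable_fst hs)]
  have := lintegral_fst_coupling hg hγ (h := s.indicator h) (hh.indicator hs)
  have e1 : (fun p : E × E => (Prod.fst ⁻¹' s).indicator (fun p => h p.1) p) =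
      fun p : E × E => s.indicator h p.1 := rfl
  have e2 : (fun y => s.indicator (fun y => (g y : ℝ≥0∞) * h y) y) =
      fun y => (g y : ℝ≥0∞) * s.indicator h y := by
    ext y
    by_cases hy : y ∈ s <;> simp [hy]
  rw [e1, e2, this]

lemma mix_c (ν : Measure E) (f g : E → NNReal) (hf : Measurable f) (hg : Measurable g)
    (hf1 : ∫⁻ y, f y ∂ν = 1) (hg1 : ∫⁻ y, g y ∂ν = 1) :
    ∫⁻ y, ((f y - g y : NNReal) : ℝ≥0∞) ∂ν = ∫⁻ y, ((g y - f y : NNReal) : ℝ≥0∞) ∂ν := by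
  have key : ∀ f g : E → NNReal, Measurable f → Measurable g →
      ∫⁻ y, ((min (f y) (g y) : NNReal) : ℝ≥0∞) ∂ν + ∫⁻ y, ((f y - g y : NNReal) : ℝ≥0∞) ∂ν =
        ∫⁻ y, f y ∂ν := by
    intro f g hf hg
    rw [← lintegral_add_left (by fun_prop)]
    congr 1 with y
    norm_cast
    rcases le_total (f y) (g y) with h | h
    · rw [min_eq_left h, tsub_eq_zero_of_le h, add_zero]
    · rw [min_eq_right h, add_tsub_cancel_of_le h]
  have h1 := key f g hf hg
  have h2 := key g f hg hf
  simp_rw [min_comm (g _) (f _)] at h2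
  rw [hf1] at h1
  rw [hg1, ← h1] at h2
  refine ((ENNReal.add_right_inj ?_).1 h2).symm
  exact ne_top_of_le_ne_top ENNReal.one_ne_top (h1 ▸ le_self_add)

lemma mix_spec (ν : Measure E) [IsProbabilityMeasure ν] (f g : E → NNReal) (hf : Measurable f)
    (hg : Measurable g) (hf1 : ∫⁻ y, f y ∂ν = 1) (hg1 : ∫⁻ y, g y ∂ν = 1) (γ : Measure (E × E))
    (hγ1 : γ.map Prod.fst = ν.withDensity (fun y => (g y : ℝ≥0∞))) (hγ2 : γ.map Prod.snd = ν) :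
    (mixM ν f g γ).map Prod.fst = ν.withDensity (fun y => (f y : ℝ≥0∞)) ∧
    (mixM ν f g γ).map Prod.snd = ν ∧
    ∫⁻ p, edist p.1 p.2 ∂(mixM ν f g γ) ≤ ∫⁻ p, edist p.1 p.2 ∂γ +
      ∫⁻ y, ((f y - g y : NNReal) + (g y - f y : NNReal) : ℝ≥0∞) * ‖y‖ₑ ∂ν := by
  have hγp : IsProbabilityMeasure γ := by
    constructor
    rw [← preimage_univ (f := Prod.snd), ← Measure.map_apply measurable_snd MeasurableSet.univ, hγ2]
    simp
  set c := ∫⁻ y, ((f y - g y : NNReal) : ℝ≥0∞) ∂ν with hc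
  have hc' : c = ∫⁻ y, ((g y - f y : NNReal) : ℝ≥0∞) ∂ν := mix_c ν f g hf hg hf1 hg1
  have hctop : c ≠ ⊤ := by
    refine ne_top_of_le_ne_top ENNReal.one_ne_top (hf1 ▸ lintegral_mono fun y => ?_)
    exact ENNReal.coe_le_coe.2 tsub_le_self
  set A := ν.withDensity (fun y => ((f y - g y : NNReal) : ℝ≥0∞)) with hA
  set G := γ.withDensity (fun p => ((1 - min (f p.1) (g p.1) / g p.1 : NNReal) : ℝ≥0∞)) with hG
  set B := G.map Prod.snd with hB
  have hAu : A univ = c := by simp [A, c, withDensity_apply]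
  have hGu : G univ = c := by
    rw [hG, withDensity_apply _ MeasurableSet.univ, setLIntegral_univ, hc',
      lintegral_fst_coupling hg hγ1
        (h := fun y => ((1 - min (f y) (g y) / g y : NNReal) : ℝ≥0∞)) (by fun_prop)]
    congr 1 with y
    rw [← mix_w_mul' (f y) (g y)]
    norm_cast
  have hBu : B univ = c := by
    rw [hB, Measure.map_apply measurable_snd MeasurableSet.univ, preimage_univ, hGu]
  have : IsFiniteMeasure A := ⟨by rw [hAu]; exact hctop.lt_top⟩
  have : IsFiniteMeasure G := ⟨by rw [hGu]; exact hctop.lt_top⟩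
  have : IsFiniteMeasure B := ⟨by rw [hBu]; exact hctop.lt_top⟩
  have hcA : c⁻¹ • (c • A) = A := by
    by_cases h0 : c = 0
    · have : A = 0 := by rw [← Measure.measure_univ_eq_zero, hAu, h0]
      simp [this]
    · rw [smul_smul, ENNReal.inv_mul_cancel h0 hctop, one_smul]
  have hcB : c⁻¹ • (c • B) = B := by
    by_cases h0 : c = 0
    · have : B = 0 := by rw [← Measure.measure_univ_eq_zero, hBu, h0]
      simp [this]
    · rw [smul_smul, ENNReal.inv_mul_cancel h0 hctop, one_smul]
  have hM : mixM ν f g γ = γ.withDensity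
      (fun p => ((min (f p.1) (g p.1) / g p.1 : NNReal) : ℝ≥0∞)) + c⁻¹ • (A.prod B) := by
    rw [mixM, withDensity_const]
  have hsumγ : γ.withDensity (fun p => ((min (f p.1) (g p.1) / g p.1 : NNReal) : ℝ≥0∞)) + G = γ := by
    rw [hG, ← withDensity_add_left (by fun_prop)]
    convert withDensity_one
    ext p
    simp only [Pi.add_apply, Pi.one_apply]
    norm_cast
    exact add_tsub_cancel_of_le (mix_w_le _ _)
  refine ⟨?_, ?_, ?_⟩
  · rw [hM, Measure.map_add _ _ measurable_fst, Measure.map_smul, Measure.map_fst_prod, hBu, hcA,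
      map_fst_withDensity hg hγ1
        (h := fun y => ((min (f y) (g y) / g y : NNReal) : ℝ≥0∞)) (by fun_prop), hA,
      ← withDensity_add_left (by fun_prop)]
    congr 1 with y
    simp only [Pi.add_apply]
    norm_cast
    rw [mix_w_mul]
    rcases le_total (f y) (g y) with h | h
    · rw [min_eq_left h, tsub_eq_zero_of_le h, add_zero]
    · rw [min_eq_right h, add_tsub_cancel_of_le h]
  · rw [hM, Measure.map_add _ _ measurable_snd, Measure.map_smul, Measure.map_snd_prod, hAu, hcB,
      hB, ← Measure.map_add _ _ measurable_snd, hsumγ, hγ2]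
  · have hAn : ∫⁻ y, ‖y‖ₑ ∂A = ∫⁻ y, ((f y - g y : NNReal) : ℝ≥0∞) * ‖y‖ₑ ∂ν := by
      rw [hA, lintegral_withDensity_eq_lintegral_mul _ (by fun_prop) (by fun_prop)]
      rfl
    have hBn : ∫⁻ z, ‖z‖ₑ ∂B ≤ ∫⁻ p, edist p.1 p.2 ∂G +
        ∫⁻ y, ((g y - f y : NNReal) : ℝ≥0∞) * ‖y‖ₑ ∂ν := by
      have e1 : ∫⁻ p, ‖p.1‖ₑ ∂G = ∫⁻ y, ((g y - f y : NNReal) : ℝ≥0∞) * ‖y‖ₑ ∂ν := by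
        rw [hG, lintegral_withDensity_eq_lintegral_mul _ (by fun_prop) (by fun_prop)]
        refine (lintegral_fst_coupling hg hγ1
          (h := fun y => ((1 - min (f y) (g y) / g y : NNReal) : ℝ≥0∞) * ‖y‖ₑ)
          (by fun_prop)).trans ?_
        congr 1 with y
        rw [← mix_w_mul' (f y) (g y), ← mul_assoc]
        norm_cast
      rw [hB, lintegral_map (by fun_prop) measurable_snd, ← e1, ← lintegral_add_left (by fun_prop)]
      refine lintegral_mono fun p => ?_
      have : edist p.2 0 ≤ edist p.2 p.1 + edist p.1 0 := edist_triangle _ _ _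
      rwa [edist_zero_right, edist_zero_right, edist_comm] at this
    have hprod : c⁻¹ * ∫⁻ p, edist p.1 p.2 ∂(A.prod B) ≤ ∫⁻ y, ‖y‖ₑ ∂A + ∫⁻ z, ‖z‖ₑ ∂B := by
      have e : ∫⁻ p, edist p.1 p.2 ∂(A.prod B) ≤ c * (∫⁻ y, ‖y‖ₑ ∂A + ∫⁻ z, ‖z‖ₑ ∂B) := by
        calc ∫⁻ p, edist p.1 p.2 ∂(A.prod B) ≤ ∫⁻ p, (‖p.1‖ₑ + ‖p.2‖ₑ) ∂(A.prod B) := by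
              refine lintegral_mono fun p => ?_
              have : edist p.1 p.2 ≤ edist p.1 0 + edist 0 p.2 := edist_triangle _ _ _
              rwa [edist_zero_right, edist_zero_left] at this
          _ = c * ∫⁻ y, ‖y‖ₑ ∂A + c * ∫⁻ z, ‖z‖ₑ ∂B := by
              rw [lintegral_add_left (by fun_prop)]
              congr 1
              · rw [lintegral_prod _ (by fun_prop)]
                simp only [lintegral_const, hBu]
                rw [lintegral_mul_const _ (by fun_prop), mul_comm]
              · rw [lintegral_prod _ (by fun_prop)]
                simp only [lintegral_const, hAu, mul_comm]
          _ = _ := by ring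
      by_cases h0 : c = 0
      · have : ∫⁻ p, edist p.1 p.2 ∂(A.prod B) = 0 := by
          simpa [h0] using e
        rw [this, mul_zero]
        exact zero_le
      · calc c⁻¹ * ∫⁻ p, edist p.1 p.2 ∂(A.prod B)
            ≤ c⁻¹ * (c * (∫⁻ y, ‖y‖ₑ ∂A + ∫⁻ z, ‖z‖ₑ ∂B)) := by gcongr
          _ = _ := by rw [← mul_assoc, ENNReal.inv_mul_cancel h0 hctop, one_mul]
    rw [hM, lintegral_add_measure, lintegral_smul_measure, smul_eq_mul]
    conv_rhs => rw [← hsumγ, lintegral_add_measure]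
    simp_rw [add_mul]
    rw [lintegral_add_left (by fun_prop), ← hAn, add_assoc]
    gcongr
    calc _ ≤ _ := hprod
      _ ≤ ∫⁻ y, ‖y‖ₑ ∂A + (∫⁻ p, edist p.1 p.2 ∂G +
        ∫⁻ y, ((g y - f y : NNReal) : ℝ≥0∞) * ‖y‖ₑ ∂ν) := by gcongr
      _ = _ := by ring
end mixing

section selection
set_option linter.unusedSectionVars false
variable {E : Type*} [NormedAddCommGroup E] [MeasurableSpace E] [BorelSpace E]
  [SecondCountableTopology E] {X : Type*} [MeasurableSpace X]

lemma nnreal_sub_add_sub (a b : NNReal) :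
    ((a - b : NNReal) : ℝ≥0∞) + (b - a : NNReal) = edist (a : ℝ) (b : ℝ) := by
  have key : ∀ a b : NNReal, a ≤ b → ((a - b : NNReal) : ℝ≥0∞) + (b - a : NNReal)
      = edist (a : ℝ) (b : ℝ) := by
    intro a b h
    rw [tsub_eq_zero_of_le h, ENNReal.coe_zero, zero_add, edist_comm, edist_dist, Real.dist_eq,
      ← NNReal.coe_sub h, NNReal.abs_eq, ENNReal.ofReal_coe_nnreal]
  rcases le_total a b with h | h
  · exact key a b h
  · rw [add_comm, edist_comm]; exact key b a h

lemma exists_partition (ν : Measure E) [IsProbabilityMeasure ν] (hν1 : ∫⁻ y, ‖y‖ₑ ∂ν ≠ ⊤)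
    (f : X → E → NNReal) (hf : Measurable (Function.uncurry f))
    (h2 : ∀ x, ∫⁻ y, (f x y : ℝ≥0∞) * ‖y‖ₑ ∂ν ≠ ⊤) (δ : ℝ≥0∞) (hδ : δ ≠ 0) :
    ∃ k : X → ℕ, Measurable k ∧ ∀ x x', k x = k x' →
      ∫⁻ y, ((f x y - f x' y : NNReal) + (f x' y - f x y : NNReal) : ℝ≥0∞) * ‖y‖ₑ ∂ν ≤ δ := by
  set m := ν.withDensity (fun y => ‖y‖ₑ) with hm
  have : IsFiniteMeasure m := isFiniteMeasure_withDensity hν1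
  have hfx : ∀ x, Measurable (f x) := fun x => hf.of_uncurry_left
  have hlin : ∀ h : E → ℝ≥0∞, Measurable h → ∫⁻ y, h y ∂m = ∫⁻ y, h y * ‖y‖ₑ ∂ν := by
    intro h hh
    rw [hm, lintegral_withDensity_eq_lintegral_mul _ (by fun_prop) hh]
    simp [mul_comm]
  have hmem : ∀ x, MemLp (fun y => (f x y : ℝ)) 1 m := by
    intro x
    have := hfx x
    refine ⟨by fun_prop, ?_⟩
    rw [eLpNorm_one_eq_lintegral_enorm, hlin _ (by fun_prop)]
    simpa using (h2 x).lt_top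
  have : Fact ((1:ℝ≥0∞) ≠ ⊤) := ⟨ENNReal.one_ne_top⟩
  let p : ℕ → Lp ℝ 1 m := TopologicalSpace.denseSeq _
  let D : ℕ → X → ℝ≥0∞ := fun n x => ∫⁻ y, edist (f x y : ℝ) (p n y) ∂m
  have hpm : ∀ n, Measurable (p n) := fun n => (Lp.stronglyMeasurable (p n)).measurable
  have hDm : ∀ n, Measurable (D n) := by
    intro n
    have := hpm n
    have hf' : Measurable (fun q : X × E => f q.1 q.2) := hf
    exact Measurable.lintegral_prod_right' (f := fun q : X × E => edist (f q.1 q.2 : ℝ) (p n q.2))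
      (by fun_prop)
  have hex : ∀ x, ∃ n, D n x < δ / 2 := by
    intro x
    have hd := TopologicalSpace.denseRange_denseSeq (Lp ℝ 1 m)
    have hδ2 : (0 : ℝ≥0∞) < δ / 2 := ENNReal.half_pos hδ
    obtain ⟨z, hz, hzd⟩ := EMetric.mem_closure_iff.1 (hd.closure_range ▸ mem_univ ((hmem x).toLp _)) _ hδ2
    obtain ⟨n, rfl⟩ := hz
    refine ⟨n, lt_of_eq_of_lt ?_ hzd⟩
    rw [Lp.edist_def, eLpNorm_one_eq_lintegral_enorm]
    refine lintegral_congr_ae ?_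
    filter_upwards [(hmem x).coeFn_toLp] with y hy
    simp only [Pi.sub_apply]
    rw [hy, edist_eq_enorm_sub]
  classical
  refine ⟨fun x => Nat.find (hex x), ?_, ?_⟩
  · exact measurable_find hex fun n => measurableSet_lt (hDm n) measurable_const
  · intro x x' hxx
    have a1 := Nat.find_spec (hex x)
    have a2 := Nat.find_spec (hex x')
    simp only at hxx
    rw [← hxx] at a2
    set n := Nat.find (hex x)
    have := hfx x
    have := hfx x'
    have := hpm n
    rw [← hlin (fun y => ((f x y - f x' y : NNReal) + (f x' y - f x y : NNReal) : ℝ≥0∞)) (by fun_prop)]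
    calc ∫⁻ y, ((f x y - f x' y : NNReal) + (f x' y - f x y : NNReal) : ℝ≥0∞) ∂m
        ≤ ∫⁻ y, (edist (f x y : ℝ) (p n y) + edist (f x' y : ℝ) (p n y)) ∂m := by
          refine lintegral_mono fun y => ?_
          simp only
          rw [nnreal_sub_add_sub]
          exact edist_triangle_right _ _ _
      _ = D n x + D n x' := lintegral_add_left (by fun_prop) _
      _ ≤ δ / 2 + δ / 2 := by gcongr
      _ = δ := ENNReal.add_halves δ

lemma exists_coupling_kernel [Nonempty X] (ν : Measure E) [IsProbabilityMeasure ν]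
    (hν1 : ∫⁻ y, ‖y‖ₑ ∂ν ≠ ⊤)
    (f : X → E → NNReal) (hf : Measurable (Function.uncurry f))
    (h1 : ∀ x, ∫⁻ y, (f x y : ℝ≥0∞) ∂ν = 1)
    (h2 : ∀ x, ∫⁻ y, (f x y : ℝ≥0∞) * ‖y‖ₑ ∂ν ≠ ⊤) (Φ : X → ℝ≥0∞)
    (hΦ : ∀ x, ∃ γ : Measure (E × E), γ.map Prod.fst = ν.withDensity (fun y => (f x y : ℝ≥0∞)) ∧
      γ.map Prod.snd = ν ∧ ∫⁻ p, edist p.1 p.2 ∂γ ≤ Φ x) (δ : ℝ≥0∞) (hδ : δ ≠ 0) :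
    ∃ K : Kernel X (E × E), IsMarkovKernel K ∧ ∀ x,
      (K x).map Prod.fst = ν.withDensity (fun y => (f x y : ℝ≥0∞)) ∧
      (K x).map Prod.snd = ν ∧ ∫⁻ p, edist p.1 p.2 ∂(K x) ≤ Φ x + δ := by
  have hfx : ∀ x, Measurable (f x) := fun x => hf.of_uncurry_left
  have hδ2 : δ / 2 ≠ 0 := (ENNReal.half_pos hδ).ne'
  obtain ⟨k, hk, hkd⟩ := exists_partition ν hν1 f hf h2 (δ / 2) hδ2
  have hr : ∀ n, ∃ r, ∀ x, k x = n → k r = n ∧ Φ r ≤ Φ x + δ / 2 := by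
    intro n
    by_cases hn : ∃ x, k x = n
    · by_cases htop : (⨅ x : {x // k x = n}, Φ x.1) = ⊤
      · obtain ⟨x0, hx0⟩ := hn
        refine ⟨x0, fun x hx => ⟨hx0, ?_⟩⟩
        rw [iInf_eq_top] at htop
        rw [htop ⟨x, hx⟩, top_add]; exact le_top
      · obtain ⟨⟨r, hr⟩, hr2⟩ := iInf_lt_iff.1 (ENNReal.lt_add_right htop hδ2)
        refine ⟨r, fun x hx => ⟨hr, hr2.le.trans ?_⟩⟩
        gcongr
        exact iInf_le (fun x : {x // k x = n} => Φ x.1) ⟨x, hx⟩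
    · push Not at hn
      exact ⟨Classical.arbitrary X, fun x hx => absurd hx (hn x)⟩
  choose r hr using hr
  choose γ hγ1 hγ2 hγ3 using hΦ
  have hγp : ∀ x, IsProbabilityMeasure (γ x) := by
    intro x
    constructor
    rw [← preimage_univ (f := Prod.snd), ← Measure.map_apply measurable_snd MeasurableSet.univ,
      hγ2]
    simp
  let Γ0 : Kernel ℕ (E × E) := ⟨fun n => γ (r n), measurable_from_top⟩
  have : IsMarkovKernel Γ0 := ⟨fun n => hγp _⟩
  let Γ : Kernel X (E × E) := Γ0.comap k hk
  let g : X → E → NNReal := fun x => f (r (k x))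
  have hg0 : Measurable (fun q : ℕ × E => f (r q.1) q.2) :=
    measurable_from_prod_countable_right fun n => hfx (r n)
  have hg : Measurable (fun q : X × E => g q.1 q.2) :=
    hg0.comp (f := fun q : X × E => (k q.1, q.2)) (by fun_prop)
  have hf' : Measurable (fun q : X × E => f q.1 q.2) := hf
  have hfp : Measurable (fun q : X × (E × E) => f q.1 q.2.1) :=
    hf'.comp (f := fun q : X × (E × E) => (q.1, q.2.1)) (by fun_prop)
  have hgp : Measurable (fun q : X × (E × E) => g q.1 q.2.1) :=
    hg.comp (f := fun q : X × (E × E) => (q.1, q.2.1)) (by fun_prop)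
  let A : Kernel X E := (Kernel.const X ν).withDensity
    (fun x y => ((f x y - g x y : NNReal) : ℝ≥0∞))
  let G : Kernel X (E × E) := Γ.withDensity
    (fun x p => ((1 - min (f x p.1) (g x p.1) / g x p.1 : NNReal) : ℝ≥0∞))
  let c : X → ℝ≥0∞ := fun x => ∫⁻ y, ((f x y - g x y : NNReal) : ℝ≥0∞) ∂ν
  have hc : Measurable c :=
    Measurable.lintegral_prod_right' (f := fun q : X × E => ((f q.1 q.2 - g q.1 q.2 : NNReal) : ℝ≥0∞))
      (by fun_prop)
  let K : Kernel X (E × E) := Γ.withDensity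
      (fun x p => ((min (f x p.1) (g x p.1) / g x p.1 : NNReal) : ℝ≥0∞)) +
    (A ×ₖ (G.map Prod.snd)).withDensity (fun x _ => (c x)⁻¹)
  have hK : ∀ x, K x = mixM ν (f x) (g x) (γ (r (k x))) := by
    intro x
    simp only [K, mixM, add_apply]
    rw [Kernel.withDensity_apply _ (by unfold Function.uncurry; fun_prop),
      Kernel.withDensity_apply _ (by unfold Function.uncurry; fun_prop), Kernel.prod_apply,
      Kernel.map_apply _ measurable_snd,
      Kernel.withDensity_apply _ (by unfold Function.uncurry; fun_prop),
      Kernel.withDensity_apply _ (by unfold Function.uncurry; fun_prop)]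
    rfl
  have hspec : ∀ x, (K x).map Prod.fst = ν.withDensity (fun y => (f x y : ℝ≥0∞)) ∧
      (K x).map Prod.snd = ν ∧ ∫⁻ p, edist p.1 p.2 ∂(K x) ≤ Φ x + δ := by
    intro x
    obtain ⟨a1, a2, a3⟩ := mix_spec ν (f x) (g x) (hfx x) (hfx _) (h1 x) (h1 _) (γ (r (k x)))
      (hγ1 _) (hγ2 _)
    rw [hK]
    refine ⟨a1, a2, a3.trans ?_⟩
    obtain ⟨b1, b2⟩ := hr (k x) x rfl
    have b3 := hkd x (r (k x)) b1.symm
    calc _ ≤ (Φ x + δ / 2) + δ / 2 := add_le_add ((hγ3 _).trans b2) b3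
      _ = Φ x + δ := by rw [add_assoc, ENNReal.add_halves]
  refine ⟨K, ⟨fun x => ⟨?_⟩⟩, hspec⟩
  rw [← preimage_univ (f := Prod.snd), ← Measure.map_apply measurable_snd MeasurableSet.univ,
      (hspec x).2.1]
  simp
end selection

section tensor
set_option linter.unusedSectionVars false

lemma cond_kl {X E : Type*} [MeasurableSpace X] [MeasurableSpace E] [StandardBorelSpace E]
    (μ : Measure X) [IsProbabilityMeasure μ] (κ : Kernel X E) [IsMarkovKernel κ]
    (ν : Measure E) [IsProbabilityMeasure ν]
    (hac : μ ⊗ₘ κ ≪ μ ⊗ₘ (Kernel.const X ν)) :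
    ∫⁻ x, klDiv (κ x) ν ∂μ = klDiv (μ ⊗ₘ κ) (μ ⊗ₘ (Kernel.const X ν)) := by
  set η := Kernel.const X ν with hη
  have hae := hac.kernel_of_compProd
  have hwd : κ =ᵐ[μ] η.withDensity (κ.rnDeriv η) := by
    filter_upwards [hae] with x hx
    rw [Kernel.withDensity_rnDeriv_eq hx]
  have hm := Kernel.measurable_rnDeriv κ η
  have hrn : (μ ⊗ₘ κ).rnDeriv (μ ⊗ₘ η) =ᵐ[μ ⊗ₘ η] fun p : X × E => κ.rnDeriv η p.1 p.2 := by
    have h1 : μ ⊗ₘ κ = (μ ⊗ₘ η).withDensity (fun p : X × E => κ.rnDeriv η p.1 p.2) := by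
      rw [Measure.compProd_congr hwd, Measure.compProd_withDensity hm]
    rw [h1]
    exact Measure.rnDeriv_withDensity _ hm
  have hk : Measurable (fun t : ℝ≥0∞ => ENNReal.ofReal (klFun t.toReal)) :=
    (measurable_klFun.comp ENNReal.measurable_toReal).ennreal_ofReal
  rw [klDiv_eq_lintegral_klFun_of_ac hac]
  rw [lintegral_congr_ae (g := fun p : X × E => ENNReal.ofReal (klFun (κ.rnDeriv η p.1 p.2).toReal))
    (by filter_upwards [hrn] with p hp; rw [hp])]
  rw [Measure.lintegral_compProd
    (f := fun p : X × E => ENNReal.ofReal (klFun (κ.rnDeriv η p.1 p.2).toReal)) (hk.comp hm)]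
  refine lintegral_congr_ae ?_
  filter_upwards [hae] with x hx
  rw [klDiv_eq_lintegral_klFun_of_ac (by simpa [hη] using hx)]
  have h2 : κ.rnDeriv η x =ᵐ[η x] (κ x).rnDeriv (η x) := Kernel.rnDeriv_eq_rnDeriv_measure
  refine lintegral_congr_ae (μ := η x) ?_
  filter_upwards [h2] with y hy
  simp only [hy]
  rw [hη, Kernel.const_apply]

lemma jensen_sqrt {X : Type*} [MeasurableSpace X] (μ : Measure X) [IsProbabilityMeasure μ]
    (h : X → ℝ≥0∞) : ∫⁻ x, (h x) ^ (1/2 : ℝ) ∂μ ≤ (∫⁻ x, h x ∂μ) ^ (1/2 : ℝ) := by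
  obtain ⟨g, hg, hgh, he⟩ := exists_measurable_le_lintegral_eq μ (fun x => (h x) ^ (1/2 : ℝ))
  rw [he]
  have := ENNReal.lintegral_mul_le_Lp_mul_Lq μ (p := 2) (q := 2) (by constructor <;> norm_num)
    hg.aemeasurable (aemeasurable_const (b := (1 : ℝ≥0∞)))
  simp only [Pi.mul_apply, mul_one, one_rpow, lintegral_const, measure_univ] at this
  refine this.trans ?_
  gcongr with x
  calc g x ^ (2:ℝ) ≤ ((h x) ^ (1/2 : ℝ)) ^ (2:ℝ) := by gcongr; exact hgh x
    _ = h x := by rw [← ENNReal.rpow_mul]; norm_num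

lemma sqrt_cs (a b A B : ℝ≥0∞) :
    (a * A) ^ (1/2 : ℝ) + (b * B) ^ (1/2 : ℝ) ≤ ((a + b) * (A + B)) ^ (1/2 : ℝ) := by
  have := ENNReal.inner_le_Lp_mul_Lq (p := 2) (q := 2) Finset.univ
    ![a ^ (1/2 : ℝ), b ^ (1/2 : ℝ)] ![A ^ (1/2 : ℝ), B ^ (1/2 : ℝ)] (by constructor <;> norm_num)
  simp only [Fin.sum_univ_two, Matrix.cons_val_zero, Matrix.cons_val_one, ← ENNReal.rpow_mul] at this
  norm_num at this
  rw [ENNReal.mul_rpow_of_nonneg _ _ (by norm_num), ENNReal.mul_rpow_of_nonneg _ _ (by norm_num),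
    ENNReal.mul_rpow_of_nonneg _ _ (by norm_num)]
  norm_num
  exact this

/-- Approximate transport-entropy inequality for a lower-integral cost. -/
def Tens {X : Type*} [MeasurableSpace X] (P : Measure X) (cost : X → X → ℝ≥0∞) (size : X → ℝ≥0∞)
    (c : ℝ≥0∞) : Prop :=
  ∀ μ : Measure X, IsProbabilityMeasure μ → ∫⁻ x, size x ∂μ ≠ ⊤ → ∀ ε : ℝ≥0∞, ε ≠ 0 →
    ∃ Γ : Measure (X × X), Γ.map Prod.fst = μ ∧ Γ.map Prod.snd = P ∧
      ∫⁻ p, cost p.1 p.2 ∂Γ ≤ (c * klDiv μ P) ^ (1/2 : ℝ) + ε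

lemma tens_step {X E : Type*} [MeasurableSpace X] [Nonempty X] [NormedAddCommGroup E]
    [MeasurableSpace E] [BorelSpace E] [SecondCountableTopology E] [StandardBorelSpace E]
    (P : Measure X) [IsProbabilityMeasure P] (ν : Measure E) [IsProbabilityMeasure ν]
    (hν1 : ∫⁻ y, ‖y‖ₑ ∂ν ≠ ⊤)
    (cost : X → X → ℝ≥0∞) (hcost : Measurable fun p : X × X => cost p.1 p.2)
    (size : X → ℝ≥0∞) (hsize : Measurable size) (a b : ℝ≥0∞) (hb : b ≠ 0) (hb' : b ≠ ⊤)
    (hX : Tens P cost size a) (hE : Tens ν (fun x y : E => edist x y) (fun y => ‖y‖ₑ) b) :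
    Tens (P.prod ν) (fun p p' : X × E => cost p.1 p'.1 + edist p.2 p'.2)
      (fun p => size p.1 + ‖p.2‖ₑ) (a + b) := by
  intro μ hμ hμs ε hε
  by_cases hfin : klDiv μ (P.prod ν) = ⊤
  · refine ⟨μ.prod (P.prod ν), by simp [Measure.map_fst_prod], by simp [Measure.map_snd_prod], ?_⟩
    rw [hfin, ENNReal.mul_top (by simp [hb]), ENNReal.top_rpow_of_pos (by norm_num), top_add]
    exact le_top
  have hac : μ ≪ P.prod ν := (klDiv_ne_top_iff.1 hfin).1
  have hdis : μ = μ.fst ⊗ₘ μ.condKernel := (μ.disintegrate μ.condKernel).symm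
  set μ1 := μ.fst with hμ1
  set κ := μ.condKernel with hκ
  set η := Kernel.const X ν with hη
  have hchain : klDiv μ (P.prod ν) = klDiv μ1 P + klDiv (μ1 ⊗ₘ κ) (μ1 ⊗ₘ η) := by
    rw [← klDiv_compProd_eq_add, ← hdis, hη, Measure.compProd_const]
  have hfin2 : klDiv (μ1 ⊗ₘ κ) (μ1 ⊗ₘ η) ≠ ⊤ := by
    intro h; rw [h, add_top] at hchain; exact hfin hchain
  have hac2 := (klDiv_ne_top_iff.1 hfin2).1
  have hae := hac2.kernel_of_compProd
  -- moments
  have hs1 : ∫⁻ x, size x ∂μ1 ≠ ⊤ := by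
    rw [hμ1, Measure.fst, lintegral_map hsize measurable_fst]
    exact ne_top_of_le_ne_top hμs (lintegral_mono fun p => le_self_add)
  have hs2 : ∀ᵐ x ∂μ1, ∫⁻ y, ‖y‖ₑ ∂(κ x) ≠ ⊤ := by
    have hm : Measurable (fun p : X × E => ‖p.2‖ₑ) := by fun_prop
    have h1 : ∫⁻ p, ‖p.2‖ₑ ∂μ ≠ ⊤ :=
      ne_top_of_le_ne_top hμs (lintegral_mono fun p => le_add_self)
    rw [hdis, Measure.lintegral_compProd hm] at h1
    have h2 := ae_lt_top (Measurable.lintegral_kernel_prod_right' hm) h1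
    filter_upwards [h2] with x hx using hx.ne
  -- the density
  let g : X → E → NNReal := fun x y => (κ.rnDeriv η x y).toNNReal
  have hg : Measurable (fun p : X × E => g p.1 p.2) :=
    (Kernel.measurable_rnDeriv κ η).ennreal_toNNReal
  have hg1 : Measurable (fun x => ∫⁻ y, (g x y : ℝ≥0∞) ∂ν) :=
    Measurable.lintegral_prod_right' (f := fun q : X × E => (g q.1 q.2 : ℝ≥0∞)) (by fun_prop)
  have hg2 : Measurable (fun x => ∫⁻ y, (g x y : ℝ≥0∞) * ‖y‖ₑ ∂ν) :=
    Measurable.lintegral_prod_right' (f := fun q : X × E => (g q.1 q.2 : ℝ≥0∞) * ‖q.2‖ₑ)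
      (by fun_prop)
  let S : Set X := {x | ∫⁻ y, (g x y : ℝ≥0∞) ∂ν = 1} ∩ {x | ∫⁻ y, (g x y : ℝ≥0∞) * ‖y‖ₑ ∂ν = ⊤}ᶜ
  have hS : MeasurableSet S :=
    (hg1 (measurableSet_singleton 1)).inter (hg2 (measurableSet_singleton ⊤)).compl
  classical
  let f : X → E → NNReal := fun x y => if x ∈ S then g x y else 1
  have hf : Measurable (fun p : X × E => f p.1 p.2) :=
    Measurable.ite (measurable_fst hS) hg measurable_const
  have hf1 : ∀ x, ∫⁻ y, (f x y : ℝ≥0∞) ∂ν = 1 := by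
    intro x
    by_cases hx : x ∈ S
    · simp only [f, hx, if_true]; exact hx.1
    · simp [f, hx]
  have hf2 : ∀ x, ∫⁻ y, (f x y : ℝ≥0∞) * ‖y‖ₑ ∂ν ≠ ⊤ := by
    intro x
    by_cases hx : x ∈ S
    · simp only [f, hx, if_true]; exact hx.2
    · simp only [f, hx, if_false, ENNReal.coe_one, one_mul]; exact hν1
  let ξ : Kernel X E := η.withDensity (fun x y => (f x y : ℝ≥0∞))
  have hξ : ∀ x, ξ x = ν.withDensity (fun y => (f x y : ℝ≥0∞)) := fun x =>
    Kernel.withDensity_apply _ (by unfold Function.uncurry; fun_prop) x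
  have hξm : IsMarkovKernel ξ := by
    refine ⟨fun x => ⟨?_⟩⟩
    rw [hξ, withDensity_apply _ MeasurableSet.univ, Measure.restrict_univ, hf1]
  have hξκ : κ =ᵐ[μ1] ξ := by
    filter_upwards [hae, hs2] with x hx hx2
    have hgx : Measurable (g x) := hg.of_uncurry_left
    have e1 : κ x = ν.withDensity (fun y => (g x y : ℝ≥0∞)) := by
      rw [← Kernel.withDensity_rnDeriv_eq hx, Kernel.withDensity_apply _
        (Kernel.measurable_rnDeriv κ η)]
      refine withDensity_congr_ae ?_
      filter_upwards [Kernel.rnDeriv_ne_top κ η (a := x)] with y hy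
      simp only [g]
      rw [ENNReal.coe_toNNReal hy]
    have hxS : x ∈ S := by
      refine ⟨?_, ?_⟩
      · have : κ x univ = 1 := measure_univ
        rwa [e1, withDensity_apply _ MeasurableSet.univ, Measure.restrict_univ] at this
      · intro h
        apply hx2
        rw [e1, lintegral_withDensity_eq_lintegral_mul _ (by fun_prop) (by fun_prop)]
        exact h
    rw [hξ, e1]
    simp [f, hxS]
  have h3 : ε / 3 ≠ 0 := by simp [hε]
  -- coupling kernel
  let Φ : X → ℝ≥0∞ := fun x => (b * klDiv (ξ x) ν) ^ (1/2 : ℝ) + ε / 3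
  obtain ⟨K, hKm, hK⟩ := exists_coupling_kernel ν hν1 f hf hf1 hf2 Φ (by
    intro x
    have := hE (ξ x) inferInstance (by
      rw [hξ, lintegral_withDensity_eq_lintegral_mul _ (by
        have : Measurable (f x) := hf.of_uncurry_left
        fun_prop) (by fun_prop)]
      exact hf2 x) (ε / 3) h3
    rw [hξ] at this
    simpa only [Φ, hξ] using this) (ε / 3) h3
  obtain ⟨Γ, hΓ1, hΓ2, hΓ3⟩ := hX μ1 inferInstance hs1 (ε / 3) h3
  have hΓp : IsProbabilityMeasure Γ := by
    constructor
    rw [← preimage_univ (f := Prod.snd), ← Measure.map_apply measurable_snd MeasurableSet.univ,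
      hΓ2]
    simp
  let K' : Kernel (X × X) (E × E) := K.comap Prod.fst measurable_fst
  have hφ : Measurable (fun z : (X × X) × (E × E) => ((z.1.1, z.2.1), (z.1.2, z.2.2))) := by fun_prop
  refine ⟨(Γ ⊗ₘ K').map (fun z => ((z.1.1, z.2.1), (z.1.2, z.2.2))), ?_, ?_, ?_⟩
  · rw [Measure.map_map measurable_fst hφ]
    have : μ = μ1 ⊗ₘ ξ := by rw [← Measure.compProd_congr hξκ]; exact hdis
    rw [this]
    ext s hs
    have hm : Measurable (Prod.fst ∘ fun z : (X × X) × (E × E) => ((z.1.1, z.2.1), (z.1.2, z.2.2))) :=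
      measurable_fst.comp hφ
    rw [Measure.map_apply hm hs, Measure.compProd_apply (hm hs), Measure.compProd_apply hs, ← hΓ1,
      lintegral_map (Kernel.measurable_kernel_prodMk_left hs) measurable_fst]
    refine lintegral_congr fun p => ?_
    have hs' : MeasurableSet (Prod.mk p.1 ⁻¹' s) := measurable_prodMk_left hs
    rw [hξ, ← (hK p.1).1, Measure.map_apply measurable_fst hs']
    rfl
  · rw [Measure.map_map measurable_snd hφ]
    ext s hs
    have hm : Measurable (Prod.snd ∘ fun z : (X × X) × (E × E) => ((z.1.1, z.2.1), (z.1.2, z.2.2))) :=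
      measurable_snd.comp hφ
    rw [Measure.map_apply hm hs, Measure.compProd_apply (hm hs), Measure.prod_apply hs, ← hΓ2,
      lintegral_map (measurable_measure_prodMk_left hs) measurable_snd]
    refine lintegral_congr fun p => ?_
    have hs' : MeasurableSet (Prod.mk p.2 ⁻¹' s) := measurable_prodMk_left hs
    have h5 : ν (Prod.mk p.2 ⁻¹' s) = K p.1 (Prod.snd ⁻¹' (Prod.mk p.2 ⁻¹' s)) := by
      rw [← Measure.map_apply measurable_snd hs', (hK p.1).2.1]
    rw [h5]
    rfl
  · rw [lintegral_map (by fun_prop) hφ]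
    simp only
    have hc1 : Measurable (fun z : (X × X) × (E × E) => cost z.1.1 z.1.2) := hcost.comp measurable_fst
    have hc2 : Measurable (fun z : E × E => edist z.1 z.2) := by fun_prop
    rw [lintegral_add_left hc1, Measure.lintegral_compProd hc1, Measure.lintegral_compProd (by fun_prop)]
    have e1 : ∫⁻ p : X × X, ∫⁻ _ : E × E, cost p.1 p.2 ∂K' p ∂Γ = ∫⁻ p, cost p.1 p.2 ∂Γ := by simp
    have e2 : ∫⁻ p : X × X, ∫⁻ z : E × E, edist z.1 z.2 ∂K' p ∂Γ
        = ∫⁻ x, ∫⁻ z : E × E, edist z.1 z.2 ∂K x ∂μ1 := by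
      rw [← hΓ1, lintegral_map (hc2.lintegral_kernel) measurable_fst]
      rfl
    have e3 : ∫⁻ x, ∫⁻ z : E × E, edist z.1 z.2 ∂K x ∂μ1
        ≤ (b * klDiv (μ1 ⊗ₘ κ) (μ1 ⊗ₘ η)) ^ (1/2 : ℝ) + ε / 3 + ε / 3 := by
      calc _ ≤ ∫⁻ x, (Φ x + ε / 3) ∂μ1 := lintegral_mono fun x => (hK x).2.2
        _ = ∫⁻ x, (b * klDiv (ξ x) ν) ^ (1/2 : ℝ) ∂μ1 + ε / 3 + ε / 3 := by
          simp only [Φ]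
          rw [lintegral_add_right _ measurable_const, lintegral_add_right _ measurable_const]
          simp
        _ ≤ (∫⁻ x, b * klDiv (ξ x) ν ∂μ1) ^ (1/2 : ℝ) + ε / 3 + ε / 3 := by
          gcongr; exact jensen_sqrt _ _
        _ = _ := by
          rw [← cond_kl μ1 κ ν hac2]
          congr 3
          rw [lintegral_congr_ae (g := fun x => b * klDiv (κ x) ν)
            (by filter_upwards [hξκ] with x hx; rw [hx])]
          rw [lintegral_const_mul' _ _ hb']
    simp only [] at e1 e2 e3 ⊢
    rw [e1, e2, hchain]
    calc _ ≤ ((a * klDiv μ1 P) ^ (1/2 : ℝ) + ε / 3) +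
          ((b * klDiv (μ1 ⊗ₘ κ) (μ1 ⊗ₘ η)) ^ (1/2 : ℝ) + ε / 3 + ε / 3) := add_le_add hΓ3 e3
      _ = ((a * klDiv μ1 P) ^ (1/2 : ℝ) + (b * klDiv (μ1 ⊗ₘ κ) (μ1 ⊗ₘ η)) ^ (1/2 : ℝ)) +
          (ε / 3 + ε / 3 + ε / 3) := by ring
      _ ≤ _ := by rw [ENNReal.add_thirds]; gcongr; exact sqrt_cs _ _ _ _
end tensor

section finalpart
set_option linter.unusedSectionVars false

lemma tens_transfer {X Y : Type*} [MeasurableSpace X] [MeasurableSpace Y] (P : Measure X)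
    (Q : Measure Y) [IsProbabilityMeasure Q] (φ : Y → X) (ψ : X → Y) (hφ : Measurable φ)
    (hψ : Measurable ψ) (hψφ : ∀ y, ψ (φ y) = y) (hQ : Q.map φ = P)
    (cX : X → X → ℝ≥0∞) (sX : X → ℝ≥0∞) (cY : Y → Y → ℝ≥0∞) (sY : Y → ℝ≥0∞)
    (hcY : Measurable fun p : Y × Y => cY p.1 p.2) (hsX : Measurable sX)
    (h1 : ∀ x x', cY (ψ x) (ψ x') ≤ cX x x') (h2 : ∀ y, sX (φ y) ≤ sY y) (c : ℝ≥0∞)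
    (h : Tens P cX sX c) : Tens Q cY sY c := by
  intro μ hμ hs ε hε
  have hcomp : ψ ∘ φ = id := funext hψφ
  obtain ⟨Γ, a1, a2, a3⟩ := h (μ.map φ) (Measure.isProbabilityMeasure_map hφ.aemeasurable) (by
    rw [lintegral_map hsX hφ]
    exact ne_top_of_le_ne_top hs (lintegral_mono h2)) ε hε
  have hm : Measurable (fun p : X × X => (ψ p.1, ψ p.2)) := by fun_prop
  refine ⟨Γ.map (fun p => (ψ p.1, ψ p.2)), ?_, ?_, ?_⟩
  · rw [Measure.map_map measurable_fst hm]
    have : Prod.fst ∘ (fun p : X × X => (ψ p.1, ψ p.2)) = ψ ∘ Prod.fst := rfl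
    rw [this, ← Measure.map_map hψ measurable_fst, a1, Measure.map_map hψ hφ, hcomp, Measure.map_id]
  · rw [Measure.map_map measurable_snd hm]
    have : Prod.snd ∘ (fun p : X × X => (ψ p.1, ψ p.2)) = ψ ∘ Prod.snd := rfl
    rw [this, ← Measure.map_map hψ measurable_snd, a2, ← hQ, Measure.map_map hψ hφ, hcomp,
      Measure.map_id]
  · rw [lintegral_map hcY hm]
    refine (lintegral_mono fun p => h1 _ _).trans (a3.trans ?_)
    gcongr
    rw [← hQ]
    exact klDiv_map_le μ Q hφ

lemma tens_pi {E : Type*} [NormedAddCommGroup E]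
    [MeasurableSpace E] [BorelSpace E] [SecondCountableTopology E] [StandardBorelSpace E]
    (ν : Measure E) [IsProbabilityMeasure ν]
    (hν1 : ∫⁻ y, ‖y‖ₑ ∂ν ≠ ⊤) (b : ℝ≥0∞) (hb : b ≠ 0) (hb' : b ≠ ⊤)
    (hE : Tens ν (fun x y : E => edist x y) (fun y => ‖y‖ₑ) b) (q : ℕ) :
    Tens (Measure.pi fun _ : Fin q => ν) (fun x y => ∑ i, edist (x i) (y i))
      (fun x => ∑ i, ‖x i‖ₑ) (q * b) := by
  induction q with
  | zero =>
    intro μ hμ _ ε _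
    refine ⟨μ.prod (Measure.pi fun _ => ν), by simp [Measure.map_fst_prod],
      by simp [Measure.map_snd_prod], by simp⟩
  | succ n ih =>
    have hst := tens_step (Measure.pi fun _ : Fin n => ν) ν hν1 _ (by fun_prop) _ (by fun_prop)
      (n * b) b hb hb' ih hE
    have e : ((n + 1 : ℕ) : ℝ≥0∞) * b = n * b + b := by push_cast; ring
    rw [e]
    have hmp := measurePreserving_piFinSuccAbove (fun _ : Fin (n+1) => ν) 0
    refine tens_transfer _ _ (fun y => (fun i => y i.succ, y 0)) (fun p => Fin.cons p.2 p.1)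
      (by fun_prop) ?_ ?_ ?_ _ _ _ _ (by fun_prop) (by fun_prop) ?_ ?_ _ hst
    · rw [measurable_pi_iff]
      intro i
      refine Fin.cases ?_ (fun j => ?_) i
      · simp only [Fin.cons_zero]; fun_prop
      · simp only [Fin.cons_succ]; fun_prop
    · intro y
      exact Fin.cons_self_tail y
    · rw [← Measure.prod_swap]
      have := hmp.map_eq
      rw [← this, Measure.map_map measurable_swap (MeasurableEquiv.measurable _)]
      rfl
    · intro x x'
      simp only [Fin.sum_univ_succ, Fin.cons_zero, Fin.cons_succ]
      rw [add_comm]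
    · intro y
      simp only [Fin.sum_univ_succ]
      rw [add_comm]

lemma tens_base {d : ℕ} (ν : Measure (Ed d)) [IsProbabilityMeasure ν]
    (hν1 : ∫⁻ y, ‖y‖ₑ ∂ν ≠ ⊤) (lam : ℝ) (hlam : 0 < lam)
    (hT1 : ∀ μ : Measure (Ed d), IsProbabilityMeasure μ → μ ≪ ν →
      ENNReal.ofReal (W1 μ ν) ≤ (2 * ENNReal.ofReal lam * KL μ ν) ^ (1/2 : ℝ)) :
    Tens ν (fun x y : Ed d => edist x y) (fun y => ‖y‖ₑ) (2 * ENNReal.ofReal lam) := by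
  intro μ hμ hs ε hε
  by_cases hfin : klDiv μ ν = ⊤
  · refine ⟨μ.prod ν, by simp [Measure.map_fst_prod], by simp [Measure.map_snd_prod], ?_⟩
    rw [hfin, ENNReal.mul_top (by simp [hlam]), ENNReal.top_rpow_of_pos (by norm_num), top_add]
    exact le_top
  have hac : μ ≪ ν := (klDiv_ne_top_iff.1 hfin).1
  have hT := hT1 μ hμ hac
  rw [KL_eq_klDiv] at hT
  have he0 : 0 < (min ε 1).toReal :=
    ENNReal.toReal_pos (by simp [hε]) (ne_top_of_le_ne_top ENNReal.one_ne_top (min_le_right _ _))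
  obtain ⟨r, ⟨γ, g1, g2, rfl⟩, hr⟩ := exists_lt_of_csInf_lt (s := {r | ∃ γ : Measure (Ed d × Ed d),
      γ.map Prod.fst = μ ∧ γ.map Prod.snd = ν ∧ r = ∫ p, dist p.1 p.2 ∂γ})
    ⟨_, μ.prod ν, by simp [Measure.map_fst_prod], by simp [Measure.map_snd_prod], rfl⟩
    (lt_add_of_pos_right (W1 μ ν) he0)
  refine ⟨γ, g1, g2, ?_⟩
  have hIntg : Integrable (fun p : Ed d × Ed d => dist p.1 p.2) γ := by
    refine ⟨by fun_prop, ?_⟩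
    have m1 : ∫⁻ p, ‖p.1‖ₑ ∂γ ≠ ⊤ := by
      rw [← lintegral_map (f := fun y : Ed d => ‖y‖ₑ) (by fun_prop) measurable_fst, g1]; exact hs
    have m2 : ∫⁻ p, ‖p.2‖ₑ ∂γ ≠ ⊤ := by
      rw [← lintegral_map (f := fun y : Ed d => ‖y‖ₑ) (by fun_prop) measurable_snd, g2]; exact hν1
    refine lt_of_le_of_lt ?_ (ENNReal.add_lt_top.2 ⟨m1.lt_top, m2.lt_top⟩)
    rw [← lintegral_add_left (by fun_prop)]
    refine lintegral_mono fun p => ?_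
    simp only
    rw [dist_eq_norm, enorm_norm]
    exact enorm_sub_le
  have h5 : ∫⁻ p, edist p.1 p.2 ∂γ = ENNReal.ofReal (∫ p, dist p.1 p.2 ∂γ) := by
    rw [ofReal_integral_eq_lintegral_ofReal hIntg (ae_of_all _ fun p => dist_nonneg)]
    simp only [edist_dist]
  calc ∫⁻ p, edist p.1 p.2 ∂γ = ENNReal.ofReal (∫ p, dist p.1 p.2 ∂γ) := h5
    _ ≤ ENNReal.ofReal (W1 μ ν + (min ε 1).toReal) := ENNReal.ofReal_le_ofReal hr.le
    _ ≤ ENNReal.ofReal (W1 μ ν) + ENNReal.ofReal (min ε 1).toReal := ENNReal.ofReal_add_le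
    _ ≤ _ := add_le_add hT (ENNReal.ofReal_toReal_le.trans (min_le_left _ _))

lemma l2cost_measurable {d q : ℕ} :
    Measurable (fun p : (Fin q → Ed d) × (Fin q → Ed d) => l2cost p.1 p.2) := by
  unfold l2cost
  fun_prop

lemma l2cost_ge {d q : ℕ} (x y : Fin q → Ed d) (i : Fin q) : ‖x i - y i‖ ≤ l2cost x y := by
  unfold l2cost
  refine Real.le_sqrt_of_sq_le ?_
  exact Finset.single_le_sum (f := fun i => ‖x i - y i‖ ^ 2) (fun _ _ => by positivity)
    (Finset.mem_univ i)

lemma l2cost_le {d q : ℕ} (x y : Fin q → Ed d) :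
    ENNReal.ofReal (l2cost x y) ≤ ∑ i, edist (x i) (y i) := by
  have h : l2cost x y ≤ ∑ i, ‖x i - y i‖ := by
    unfold l2cost
    refine Real.sqrt_le_iff.2 ⟨by positivity, ?_⟩
    exact Finset.sum_sq_le_sq_sum_of_nonneg (fun _ _ => by positivity)
  refine (ENNReal.ofReal_le_ofReal h).trans ?_
  rw [ENNReal.ofReal_sum_of_nonneg (fun _ _ => by positivity)]
  refine Finset.sum_le_sum fun i _ => ?_
  rw [edist_dist, dist_eq_norm]

lemma w1q_le {d q : ℕ} (μ P : Measure (Fin q → Ed d)) (Γ : Measure ((Fin q → Ed d) × (Fin q → Ed d)))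
    (h1 : Γ.map Prod.fst = μ) (h2 : Γ.map Prod.snd = P) :
    W1q μ P ≤ ∫ p, l2cost p.1 p.2 ∂Γ := by
  refine csInf_le ⟨0, ?_⟩ ⟨Γ, h1, h2, rfl⟩
  rintro r ⟨γ, -, -, rfl⟩
  exact integral_nonneg fun p => Real.sqrt_nonneg _

lemma part_a {d : ℕ} (ν : Measure (Ed d)) [IsProbabilityMeasure ν]
    (hν1 : ∫⁻ y, ‖y‖ₑ ∂ν ≠ ⊤) (lam : ℝ) (hlam : 0 < lam)
    (hT1 : ∀ μ : Measure (Ed d), IsProbabilityMeasure μ → μ ≪ ν →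
      ENNReal.ofReal (W1 μ ν) ≤ (2 * ENNReal.ofReal lam * KL μ ν) ^ (1/2 : ℝ)) (q : ℕ)
    (μ : Measure (Fin q → Ed d)) [IsProbabilityMeasure μ] :
    ENNReal.ofReal (W1q μ (Measure.pi fun _ => ν)) ≤
      (2 * ENNReal.ofReal lam * (q : ℝ≥0∞) * klDiv μ (Measure.pi fun _ => ν)) ^ (1/2 : ℝ) := by
  by_cases hs : ∫⁻ x, ∑ i, ‖x i‖ₑ ∂μ = ⊤
  · set P := Measure.pi fun _ : Fin q => ν with hP
    have h := w1q_le μ P (μ.prod P) (by simp [Measure.map_fst_prod]) (by simp [Measure.map_snd_prod])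
    have hni : ¬ Integrable (fun p : (Fin q → Ed d) × (Fin q → Ed d) => l2cost p.1 p.2) (μ.prod P) := by
      intro hIntg
      rw [lintegral_finsetSum _ (fun i _ => by fun_prop)] at hs
      obtain ⟨i, -, hi⟩ := ENNReal.sum_eq_top.1 hs
      have e1 : ∫⁻ x, ‖x i‖ₑ ∂μ = ∫⁻ p, ‖p.1 i‖ₑ ∂(μ.prod P) := by
        rw [← lintegral_map (f := fun x : Fin q → Ed d => ‖x i‖ₑ) (by fun_prop) measurable_fst]
        simp [Measure.map_fst_prod]
      have e2 : ∫⁻ p, ‖p.2 i‖ₑ ∂(μ.prod P) = ∫⁻ y, ‖y‖ₑ ∂ν := by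
        rw [← lintegral_map (f := fun x : Fin q → Ed d => ‖x i‖ₑ) (by fun_prop) measurable_snd,
          Measure.map_snd_prod, measure_univ, one_smul]
        exact (measurePreserving_eval (fun _ : Fin q => ν) i).lintegral_comp
          (f := fun y => ‖y‖ₑ) (by fun_prop)
      have e3 : ∫⁻ p, ‖p.1 i‖ₑ ∂(μ.prod P) ≤
          ∫⁻ p, ‖l2cost p.1 p.2‖ₑ ∂(μ.prod P) + ∫⁻ p, ‖p.2 i‖ₑ ∂(μ.prod P) := by
        rw [← lintegral_add_right _ (by fun_prop)]
        refine lintegral_mono fun p => ?_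
        simp only
        have k1 : ‖p.1 i - p.2 i‖ₑ ≤ ‖l2cost p.1 p.2‖ₑ := by
          rw [enorm_le_iff_norm_le]
          exact (l2cost_ge p.1 p.2 i).trans (le_abs_self _)
        calc ‖p.1 i‖ₑ = ‖(p.1 i - p.2 i) + p.2 i‖ₑ := by rw [sub_add_cancel]
          _ ≤ ‖p.1 i - p.2 i‖ₑ + ‖p.2 i‖ₑ := enorm_add_le _ _
          _ ≤ _ := by gcongr
      rw [← e1, hi, e2] at e3
      exact (ENNReal.add_lt_top.2 ⟨hIntg.2, hν1.lt_top⟩).not_ge e3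
    rw [integral_undef hni] at h
    rw [ENNReal.ofReal_eq_zero.2 h]
    exact zero_le
  · refine ENNReal.le_of_forall_pos_le_add fun ε hε _ => ?_
    obtain ⟨Γ, a1, a2, a3⟩ := tens_pi ν hν1 (2 * ENNReal.ofReal lam) (by simp [hlam])
      (by finiteness) (tens_base ν hν1 lam hlam hT1) q μ inferInstance hs ε (by simpa using hε.ne')
    have e : (q : ℝ≥0∞) * (2 * ENNReal.ofReal lam) = 2 * ENNReal.ofReal lam * q := by ring
    rw [e] at a3
    refine le_trans ?_ a3
    calc ENNReal.ofReal (W1q μ (Measure.pi fun _ => ν))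
        ≤ ENNReal.ofReal (∫ p, l2cost p.1 p.2 ∂Γ) := ENNReal.ofReal_le_ofReal (w1q_le _ _ Γ a1 a2)
      _ ≤ ∫⁻ p, ENNReal.ofReal (l2cost p.1 p.2) ∂Γ := by
        by_cases hIntg : Integrable (fun p : (Fin q → Ed d) × (Fin q → Ed d) => l2cost p.1 p.2) Γ
        · rw [ofReal_integral_eq_lintegral_ofReal hIntg (ae_of_all _ fun p => Real.sqrt_nonneg _)]
        · rw [integral_undef hIntg]; simp
      _ ≤ _ := lintegral_mono fun p => l2cost_le _ _

end finalpart

/-- If `ν` satisfies a `T₁(λ)` inequality then, for any exchangeable `π`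
on `(ℝ^d)^N` with `q`-marginal `π^{(q)}`,
`W₁(π^{(q)}, ν^{⊗q}) ≤ √(2λq·KL(π^{(q)}‖ν^{⊗q})) ≤ C·(q/√N)·√(λ·KL(π‖ν^{⊗N}))`. -/
theorem stmt14 {d : ℕ} (ν : Measure (Ed d)) (hν : IsProbabilityMeasure ν)
    (hν1 : HasFiniteIntegral (fun x => ‖x‖) ν)
    (lam : ℝ) (hlam : 0 < lam)
    (hT1 : ∀ μ : Measure (Ed d), IsProbabilityMeasure μ → μ ≪ ν →
      ENNReal.ofReal (W1 μ ν) ≤ (2 * ENNReal.ofReal lam * KL μ ν) ^ (1/2 : ℝ)) :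
    ∃ C : ℝ, 0 < C ∧ ∀ (N : ℕ), 0 < N → ∀ π : Measure (Fin N → Ed d),
      IsProbabilityMeasure π →
      (∀ σ : Equiv.Perm (Fin N), π.map (fun x => x ∘ σ) = π) →
      ∀ (q : ℕ) (hq1 : 1 ≤ q) (hqN : q ≤ N),
        ENNReal.ofReal (W1q (π.map fun x (i : Fin q) => x (Fin.castLE hqN i))
            (Measure.pi fun _ : Fin q => ν))
          ≤ (2 * ENNReal.ofReal lam * (q : ℝ≥0∞) *
              KL (π.map fun x (i : Fin q) => x (Fin.castLE hqN i))
                 (Measure.pi fun _ : Fin q => ν)) ^ (1/2 : ℝ)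
        ∧ (2 * ENNReal.ofReal lam * (q : ℝ≥0∞) *
              KL (π.map fun x (i : Fin q) => x (Fin.castLE hqN i))
                 (Measure.pi fun _ : Fin q => ν)) ^ (1/2 : ℝ)
          ≤ ENNReal.ofReal C * ((q : ℝ≥0∞) / ENNReal.ofReal (Real.sqrt N)) *
              (ENNReal.ofReal lam * KL π (Measure.pi fun _ : Fin N => ν)) ^ (1/2 : ℝ) := by
  have hν2 : ∫⁻ y, ‖y‖ₑ ∂ν ≠ ⊤ := by
    have := hν1.ne
    simpa using this
  refine ⟨2, by norm_num, fun N hN π hπ hex q hq1 hqN => ?_⟩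
  have hm : Measurable (fun (x : Fin N → Ed d) (i : Fin q) => x (Fin.castLE hqN i)) := by fun_prop
  have hp : IsProbabilityMeasure (π.map fun x (i : Fin q) => x (Fin.castLE hqN i)) :=
    Measure.isProbabilityMeasure_map hm.aemeasurable
  rw [KL_eq_klDiv, KL_eq_klDiv]
  exact ⟨part_a ν hν2 lam hlam hT1 q _, final_arith lam N q hN _ _ (csiszar ν N q hq1 hqN π hπ hex)⟩
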